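/- arXiv:1002.2485 — 2 statements merged into one kernel-verified Lean document; each statement's English description precedes it below -/
import Mathlib

section
/- Let q, t, z, w be independent indeterminates over ℚ and work in the rational function field ℚ(q,t,z,w). For all natural numbers θ, ρ one has ∏_{l=1}^{θ} ∏_{k=1}^{ρ} γ₊(q^{-l}z, q^{-k}w; q,t) = (q^{ρ−θ+1}·z/w; q)_θ · (q^{-θ} t·z/w; q)_θ / ( (q^{-θ+1}·z/w; q)_θ · (q^{ρ−θ} t·z/w; q)_θ ). -/
noncomputable section

/-- The field ℚ(q,t,z,w) of rational functions in four independent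
indeterminates over ℚ. -/
abbrev K : Type := FractionRing (MvPolynomial (Fin 4) ℚ)

def q : K := algebraMap (MvPolynomial (Fin 4) ℚ) K (MvPolynomial.X 0)
def t : K := algebraMap (MvPolynomial (Fin 4) ℚ) K (MvPolynomial.X 1)
def z : K := algebraMap (MvPolynomial (Fin 4) ℚ) K (MvPolynomial.X 2)
def w : K := algebraMap (MvPolynomial (Fin 4) ℚ) K (MvPolynomial.X 3)

/-- The q-Pochhammer symbol `(u;q)_n = ∏_{i=0}^{n-1} (1 - qⁱ u)`. -/
def qPoch (q u : K) (n : ℕ) : K := ∏ i ∈ Finset.range n, (1 - q ^ i * u)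

/-- `γ₊(z,w;q,t) = (z - q⁻¹w)(z - q t⁻¹ w)/((z - w)(z - t⁻¹ w))`. -/
def gammaPlus (q t zz ww : K) : K :=
  (zz - q⁻¹ * ww) * (zz - q * t⁻¹ * ww) / ((zz - ww) * (zz - t⁻¹ * ww))

lemma q_ne_zero : q ≠ 0 := by simp [q]

lemma t_ne_zero : t ≠ 0 := by simp [t]

lemma w_ne_zero : w ≠ 0 := by simp [w]

lemma q_zpow_mul_ne_of_eval {a b : MvPolynomial (Fin 4) ℚ} (v : Fin 4 → ℚ) (hv : v 0 = 1)
    (ha : MvPolynomial.eval v a = 1) (hb : MvPolynomial.eval v b = 0) (n : ℤ) :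
    q ^ n * algebraMap _ K a ≠ algebraMap _ K b := by
  have inj : Function.Injective (algebraMap (MvPolynomial (Fin 4) ℚ) K) :=
    IsFractionRing.injective _ _
  intro h
  obtain ⟨m, rfl | rfl⟩ := n.eq_nat_or_neg
  · rw [zpow_natCast, q, ← map_pow, ← map_mul] at h
    have := congrArg (MvPolynomial.eval v) (inj h)
    simp [hv, ha, hb] at this
  · rw [zpow_neg, zpow_natCast, inv_mul_eq_iff_eq_mul₀ (pow_ne_zero _ q_ne_zero), q, ← map_pow,
      ← map_mul] at h
    have := congrArg (MvPolynomial.eval v) (inj h)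
    simp [ha, hb] at this

lemma one_sub_zpow_mul_ne_zero (n : ℤ) : 1 - q ^ n * (z / w) ≠ 0 := by
  rw [sub_ne_zero, ← mul_div_assoc, ne_comm, Ne, div_eq_one_iff_eq w_ne_zero]
  exact q_zpow_mul_ne_of_eval ![1, 1, 1, 0] (by simp) (by simp) (by simp) n

lemma one_sub_zpow_mul_t_mul_ne_zero (n : ℤ) : 1 - q ^ n * t * (z / w) ≠ 0 := by
  rw [sub_ne_zero, ← mul_div_assoc, ne_comm, Ne, div_eq_one_iff_eq w_ne_zero, mul_assoc, t, z,
    ← map_mul]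
  exact q_zpow_mul_ne_of_eval ![1, 1, 1, 0] (by simp) (by simp) (by simp) n

lemma gammaPlus_mul_right {q t y : K} (hq : q ≠ 0) (ht : t ≠ 0) (hy : y ≠ 0) (v : K) :
    gammaPlus q t (v * y) y
      = (1 - q * v) * (1 - q⁻¹ * t * v) / ((1 - v) * (1 - t * v)) := by
  have hc : t⁻¹ * y ^ 2 ≠ 0 := by positivity
  rw [gammaPlus, ← mul_div_mul_left (_ * (1 - q⁻¹ * t * v)) _ hc]
  congr 1 <;> field_simp <;> ring

lemma gammaPlus_shift (l k : ℕ) :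
    gammaPlus q t (q⁻¹ ^ l * z) (q⁻¹ ^ k * w)
      = (1 - q ^ ((k : ℤ) + 1 - l) * (z / w)) * (1 - q ^ ((k : ℤ) - 1 - l) * t * (z / w))
        / ((1 - q ^ ((k : ℤ) - l) * (z / w)) * (1 - q ^ ((k : ℤ) - l) * t * (z / w))) := by
  have hq := q_ne_zero
  have hw := w_ne_zero
  have hz : q⁻¹ ^ l * z = q ^ ((k : ℤ) - l) * (z / w) * (q⁻¹ ^ k * w) := by
    rw [zpow_sub₀ hq, zpow_natCast, zpow_natCast, inv_pow, inv_pow]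
    field_simp
  rw [hz, gammaPlus_mul_right hq t_ne_zero (mul_ne_zero (pow_ne_zero _ (inv_ne_zero hq)) hw),
    show (k : ℤ) + 1 - l = 1 + (k - l) by ring, show (k : ℤ) - 1 - l = -1 + (k - l) by ring,
    zpow_add₀ hq, zpow_add₀ hq, zpow_one, zpow_neg_one]
  ring

lemma prod_gammaPlus_shift (l ρ : ℕ) :
    ∏ k ∈ Finset.Icc 1 ρ, gammaPlus q t (q⁻¹ ^ l * z) (q⁻¹ ^ k * w)
      = (1 - q ^ ((ρ : ℤ) + 1 - l) * (z / w)) * (1 - q ^ (-(l : ℤ)) * t * (z / w))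
        / ((1 - q ^ ((1 : ℤ) - l) * (z / w)) * (1 - q ^ ((ρ : ℤ) - l) * t * (z / w))) := by
  induction ρ with
  | zero =>
    have h₁ := one_sub_zpow_mul_ne_zero (1 - l)
    have h₂ := one_sub_zpow_mul_t_mul_ne_zero (-l)
    simp only [Nat.cast_zero, zero_add, zero_sub]
    rw [div_self (mul_ne_zero h₁ h₂)]
    simp
  | succ ρ ih =>
    rw [Finset.prod_Icc_succ_top (by lia), ih, gammaPlus_shift]
    push_cast
    rw [show (ρ : ℤ) + 1 - 1 - l = ρ - l by ring]
    have h₁ := one_sub_zpow_mul_ne_zero (1 - l)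
    have h₂ := one_sub_zpow_mul_t_mul_ne_zero (ρ - l)
    have h₃ := one_sub_zpow_mul_ne_zero (ρ + 1 - l)
    have h₄ := one_sub_zpow_mul_t_mul_ne_zero (ρ + 1 - l)
    rw [div_mul_div_comm, div_eq_div_iff (by simp only [mul_ne_zero_iff]; tauto)
      (mul_ne_zero h₁ h₄)]
    ring

lemma qPoch_zpow_mul (m : ℤ) (y : K) (θ : ℕ) :
    qPoch q (q ^ (m - θ) * y) θ = ∏ l ∈ Finset.Icc 1 θ, (1 - q ^ (m - l) * y) := by
  rw [qPoch, ← Finset.prod_range_reflect, ← Finset.Ico_add_one_right_eq_Icc,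
    Finset.prod_Ico_eq_prod_range]
  refine Finset.prod_congr (by simp) fun i hi => ?_
  have hi : i < θ := by simpa using hi
  rw [← zpow_natCast, ← mul_assoc, ← zpow_add₀ q_ne_zero]
  congr 3
  lia

/-- `∏_{l=1}^θ ∏_{k=1}^ρ γ₊(q^{-l}z, q^{-k}w; q,t)
  = (q^{ρ-θ+1} z/w;q)_θ (q^{-θ} t z/w;q)_θ / ((q^{-θ+1} z/w;q)_θ (q^{ρ-θ} t z/w;q)_θ)`. -/
theorem stmt3 (θ ρ : ℕ) :
    (∏ l ∈ Finset.Icc 1 θ, ∏ k ∈ Finset.Icc 1 ρ,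
        gammaPlus q t (q⁻¹ ^ l * z) (q⁻¹ ^ k * w))
    = qPoch q (q ^ ((ρ : ℤ) - θ + 1) * (z / w)) θ
        * qPoch q (q ^ (-(θ : ℤ)) * t * (z / w)) θ
        / (qPoch q (q ^ ((1 : ℤ) - θ) * (z / w)) θ
            * qPoch q (q ^ ((ρ : ℤ) - θ) * t * (z / w)) θ) := by
  simp only [mul_assoc _ t]
  rw [show (ρ : ℤ) - θ + 1 = ρ + 1 - θ by ring, show -(θ : ℤ) = 0 - θ by ring]
  simp only [qPoch_zpow_mul, prod_gammaPlus_shift]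
  simp only [Finset.prod_div_distrib, Finset.prod_mul_distrib, zero_sub, mul_assoc _ t]

end
end

section
/- Let F be a field, let m ≥ 1 be an integer, let P ∈ F with P ≠ 0 and P^m ≠ 1, and set A := (1 − P^{-1})/(1 − P^m). Then for all i, j with 1 ≤ i < j ≤ m one has A^2 · Σ_{k=1}^{m} P^{2m−k+1} + (1 − P^{-1}) A · Σ_{k=1}^{j−1} P^{m−k+1} + A P^{m} + A P^{m−j+1} + (1 − P^{-1}) = (1 − P^{m−1})/(1 − P^{m}) − P^{-1}. -/
/-- Telescoping form of the descending geometric sum `P ^ N + ⋯ + P ^ (N - n + 1)`. -/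
theorem one_sub_inv_mul_sum_pow_sub {F : Type*} [Field F] {P : F} (hP : P ≠ 0) {n N : ℕ}
    (h : n ≤ N) :
    (1 - P⁻¹) * ∑ k ∈ Finset.Icc 1 n, P ^ (N - k + 1) = P ^ N - P ^ (N - n) := by
  induction n with
  | zero => simp
  | succ n ih =>
    rw [Finset.sum_Icc_succ_top (by omega), mul_add, ih (by omega),
      show N - n = N - (n + 1) + 1 by omega, pow_succ]
    field_simp
    ring

/-- the off-diagonal (i < j) normal-ordering coefficient identity for
`f_{1,m}(w/z) Λ_i(z) Λ_j(w) = :Λ_i(z)Λ_j(w): γ₊(z,w;q,p)` in a general field. -/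
theorem stmt14 {F : Type*} [Field F] (m : ℕ) (hm : 1 ≤ m) (P : F) (hP : P ≠ 0)
    (hPm : P ^ m ≠ 1) (i j : ℕ) (hi1 : 1 ≤ i) (hij : i < j) (hjm : j ≤ m) :
    ((1 - P⁻¹) / (1 - P ^ m)) ^ 2 * (∑ k ∈ Finset.Icc 1 m, P ^ (2 * m - k + 1))
      + (1 - P⁻¹) * ((1 - P⁻¹) / (1 - P ^ m)) *
          (∑ k ∈ Finset.Icc 1 (j - 1), P ^ (m - k + 1))
      + ((1 - P⁻¹) / (1 - P ^ m)) * P ^ m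
      + ((1 - P⁻¹) / (1 - P ^ m)) * P ^ (m - j + 1)
      + (1 - P⁻¹)
    = (1 - P ^ (m - 1)) / (1 - P ^ m) - P⁻¹ := by
  have hD : 1 - P ^ m ≠ 0 := sub_ne_zero.mpr hPm.symm
  have h₁ := one_sub_inv_mul_sum_pow_sub hP (show m ≤ 2 * m by omega)
  have h₂ := one_sub_inv_mul_sum_pow_sub hP (show j - 1 ≤ m by omega)
  rw [show 2 * m - m = m by omega, two_mul m, pow_add, ← two_mul] at h₁
  rw [show m - (j - 1) = m - j + 1 by omega] at h₂
  have hR : (1 - P ^ (m - 1)) / (1 - P ^ m) = 1 + (1 - P⁻¹) / (1 - P ^ m) * P ^ m := by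
    obtain ⟨n, rfl⟩ := Nat.exists_eq_add_of_le' hm
    rw [Nat.add_sub_cancel]
    field_simp
    ring
  have h₃ : ((1 - P⁻¹) / (1 - P ^ m)) ^ 2 * (∑ k ∈ Finset.Icc 1 m, P ^ (2 * m - k + 1))
      = -((1 - P⁻¹) / (1 - P ^ m) * P ^ m) := by
    rw [div_pow, sq (1 - P⁻¹), div_mul_eq_mul_div, mul_assoc, h₁]
    field_simp
    ring
  rw [h₃, hR]
  linear_combination (1 - P⁻¹) / (1 - P ^ m) * h₂
end
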